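/- arXiv:1809.06581 — 2 statements merged into one kernel-verified Lean document; each statement's English description precedes it below -/
import Mathlib

section
/- Let ρ_X be a probability density on ℝ^n with open support 𝒳, and let f : 𝒳 → ℝ be continuously differentiable with partial derivatives square-integrable with respect to ρ_X. Let C = ∫_𝒳 ∇f(x) ∇f(x)ᵀ ρ_X(x) dx and let C = W Λ Wᵀ be an orthogonal eigendecomposition with eigenvalues λ₁ ≥ ⋯ ≥ λ_n ≥ 0 on the diagonal of Λ and eigenvector matrix W = [W₁ W₂], W₁ ∈ ℝ^{n×k}. Then ∫_𝒳 ‖W₂ᵀ∇f(x)‖² ρ_X(x) dx = λ_{k+1} + ⋯ + λ_n, where ‖·‖ is the Euclidean norm. -/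
open MeasureTheory Matrix Set

/-- The vector of partial derivatives (gradient) of `f : ℝ^n → ℝ`. -/
noncomputable def pgrad {n : ℕ} (f : (Fin n → ℝ) → ℝ) (x : Fin n → ℝ) : Fin n → ℝ :=
  fun i => fderiv ℝ f x (Pi.single i 1)

/-- Let `C = ∫ ∇f ∇fᵀ ρX dx = W Λ Wᵀ` be an orthogonal eigendecomposition with
descending nonnegative eigenvalues and `W = [W₁ W₂]`, `W₂` the last `m` columns. Then the
averaged squared Euclidean norm of `W₂ᵀ∇f` equals the sum of the trailing eigenvalues:
`∫ ‖W₂ᵀ∇f(x)‖² ρX(x) dx = λ_{k+1} + ⋯ + λ_{k+m}`. -/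
theorem inactive_gradient_energy
    (k m : ℕ)
    (ρX : (Fin (k + m) → ℝ) → ℝ)
    (hnonneg : ∀ x, 0 ≤ ρX x)
    (hint : Integrable ρX)
    (hprob : ∫ x, ρX x = 1)
    (hopen : IsOpen {x | 0 < ρX x})
    (f : (Fin (k + m) → ℝ) → ℝ)
    (hf : ContDiff ℝ 1 f)
    (hsq : ∀ i, Integrable fun x => (pgrad f x i) ^ 2 * ρX x)
    (W : Matrix (Fin (k + m)) (Fin (k + m)) ℝ)
    (hW : Wᵀ * W = 1)
    (Λ : Fin (k + m) → ℝ)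
    (hΛdesc : ∀ i j, i ≤ j → Λ j ≤ Λ i)
    (hΛnonneg : ∀ i, 0 ≤ Λ i)
    (hC : (Matrix.of fun i j => ∫ x, pgrad f x i * pgrad f x j * ρX x) =
      W * Matrix.diagonal Λ * Wᵀ) :
    ∫ x, (∑ j : Fin m, ((W.submatrix id (Fin.natAdd k))ᵀ *ᵥ pgrad f x) j ^ 2) * ρX x =
      ∑ j : Fin m, Λ (Fin.natAdd k j) := by
  have hcont : ∀ i, Continuous fun x => pgrad f x i := by
    intro i
    exact (hf.continuous_fderiv (by norm_num)).clm_apply continuous_const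
  have hI : ∀ i j, Integrable fun x => pgrad f x i * pgrad f x j * ρX x := by
    intro i j
    refine ((hsq i).add (hsq j)).mono
      (((hcont i).mul (hcont j)).aestronglyMeasurable.mul hint.aestronglyMeasurable) ?_
    filter_upwards with x
    simp only [Pi.add_apply]
    rw [Real.norm_eq_abs, Real.norm_eq_abs, ← add_mul, abs_mul, abs_mul (_ + _)]
    refine mul_le_mul_of_nonneg_right ?_ (abs_nonneg _)
    rw [abs_of_nonneg (by positivity : 0 ≤ pgrad f x i ^ 2 + pgrad f x j ^ 2)]
    rw [abs_le]
    constructor <;> nlinarith [sq_nonneg (pgrad f x i + pgrad f x j),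
      sq_nonneg (pgrad f x i - pgrad f x j), sq_nonneg (pgrad f x i), sq_nonneg (pgrad f x j)]
  have hexp : ∀ x, (∑ j : Fin m, ((W.submatrix id (Fin.natAdd k))ᵀ *ᵥ pgrad f x) j ^ 2) * ρX x
      = ∑ j : Fin m, ∑ a, ∑ b, W a (Fin.natAdd k j) * W b (Fin.natAdd k j) *
        (pgrad f x a * pgrad f x b * ρX x) := by
    intro x
    rw [Finset.sum_mul]
    refine Finset.sum_congr rfl fun j _ => ?_
    simp only [mulVec, dotProduct, transpose_apply, submatrix_apply, id]
    rw [sq, Finset.sum_mul_sum, Finset.sum_mul]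
    refine Finset.sum_congr rfl fun a _ => ?_
    rw [Finset.sum_mul]
    refine Finset.sum_congr rfl fun b _ => ?_
    ring
  have hD : Wᵀ * (Matrix.of fun i j => ∫ x, pgrad f x i * pgrad f x j * ρX x) * W
      = Matrix.diagonal Λ := by
    rw [hC]
    calc Wᵀ * (W * Matrix.diagonal Λ * Wᵀ) * W
        = (Wᵀ * W) * Matrix.diagonal Λ * (Wᵀ * W) := by simp only [Matrix.mul_assoc]
      _ = _ := by rw [hW, Matrix.one_mul, Matrix.mul_one]
  simp_rw [hexp]
  rw [integral_finsetSum _ fun j _ => integrable_finsetSum _ fun a _ =>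
    integrable_finsetSum _ fun b _ => (hI a b).const_mul _]
  refine Finset.sum_congr rfl fun j _ => ?_
  rw [integral_finsetSum _ fun a _ =>
    integrable_finsetSum _ fun b _ => (hI a b).const_mul _]
  have h := congrFun (congrFun hD (Fin.natAdd k j)) (Fin.natAdd k j)
  rw [diagonal_apply_eq, Matrix.mul_apply] at h
  simp only [Matrix.mul_apply, transpose_apply, of_apply, Finset.sum_mul] at h
  rw [← h, Finset.sum_comm]
  refine Finset.sum_congr rfl fun a _ => ?_
  rw [integral_finsetSum _ fun b _ => (hI a b).const_mul _]
  refine Finset.sum_congr rfl fun b _ => ?_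
  rw [integral_const_mul]
  ring
end

section
/- Let ρ_X be the standard normal density on ℝ^n (so 𝒳 = ℝ^n), let f : ℝ^n → ℝ be continuously differentiable with partial derivatives square-integrable with respect to ρ_X, let C = ∫ ∇f ∇fᵀ ρ_X dx = W Λ Wᵀ be an orthogonal eigendecomposition with eigenvalues λ₁ ≥ ⋯ ≥ λ_n ≥ 0 and W = [W₁ W₂], W₁ ∈ ℝ^{n×k}. Define g(y) = ∫_{ℝ^{n−k}} f(W₁y + W₂z) φ_{n−k}(z) dz, where φ_{n−k} is the standard normal density on ℝ^{n−k}, and f_g(x) = g(W₁ᵀx). Then ∫_{ℝ^n} (f(x) − f_g(x))² ρ_X(x) dx ≤ λ_{k+1} + ⋯ + λ_n. -/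
open MeasureTheory Matrix Set

/-- The standard normal density on `ℝ^n`. -/
noncomputable def gaussDensity (n : ℕ) (x : Fin n → ℝ) : ℝ :=
  (2 * Real.pi) ^ (-(n : ℝ) / 2) * Real.exp (-(∑ i, x i ^ 2) / 2)

open ProbabilityTheory

noncomputable abbrev g1 : Measure ℝ := gaussianReal 0 1
noncomputable abbrev gN (n : ℕ) : Measure (Fin n → ℝ) := Measure.pi (fun _ => g1)

lemma gaussDensity_eq_prod (n : ℕ) (x : Fin n → ℝ) :
    gaussDensity n x = ∏ i, gaussianPDFReal 0 1 (x i) := by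
  unfold gaussDensity gaussianPDFReal
  rw [Finset.prod_mul_distrib, ← Real.exp_sum]
  congr 1
  · simp only [NNReal.coe_one, mul_one, Finset.prod_const, Finset.card_univ, Fintype.card_fin]
    rw [Real.sqrt_eq_rpow, ← Real.rpow_neg (by positivity), ← Real.rpow_natCast, ← Real.rpow_mul (by positivity)]
    congr 1; ring
  · congr 1
    simp [neg_div, Finset.sum_div]

lemma gN_eq (n : ℕ) : gN n = volume.withDensity (fun x => ENNReal.ofReal (gaussDensity n x)) := by
  apply Measure.pi_eq
  intro s hs
  rw [withDensity_apply _ (MeasurableSet.univ_pi hs), volume_pi, Measure.restrict_pi_pi]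
  simp_rw [gaussDensity_eq_prod]
  rw [← ofReal_integral_eq_lintegral_ofReal]
  · rw [integral_fintype_prod_eq_prod (fun i => gaussianPDFReal 0 1), ENNReal.ofReal_prod_of_nonneg]
    · simp_rw [gaussianReal_apply_eq_integral 0 one_ne_zero]
    · intro i _
      exact integral_nonneg fun x => gaussianPDFReal_nonneg _ _ _
  · exact Integrable.fintype_prod (fun i => (integrable_gaussianPDFReal 0 1).restrict)
  · exact ae_of_all _ fun x => Finset.prod_nonneg fun i _ => gaussianPDFReal_nonneg _ _ _

lemma pdf_def' : gaussianPDFReal 0 1 = fun x => (√(2 * Real.pi))⁻¹ * Real.exp (-x^2/2) := by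
  ext x; simp [gaussianPDFReal]

lemma pdf_hasDeriv (x : ℝ) :
    HasDerivAt (fun x => - gaussianPDFReal 0 1 x) (gaussianPDFReal 0 1 x * x) x := by
  rw [pdf_def']
  have : HasDerivAt (fun x : ℝ => -x^2 / 2) (-x) x := by
    have := (hasDerivAt_pow 2 x).neg.div_const 2
    refine this.congr_deriv ?_
    simp
    ring
  refine (this.exp.const_mul (√(2 * Real.pi))⁻¹).neg.congr_deriv ?_
  ring

lemma g1_eq : g1 = volume.withDensity (gaussianPDF 0 1) := gaussianReal_of_var_ne_zero _ one_ne_zero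

lemma pdf_int : Integrable (fun x => gaussianPDFReal 0 1 x * x) := by
  have h : Integrable (fun x : ℝ => x) g1 := (memLp_id_gaussianReal 1).integrable (by simp)
  rw [g1_eq, integrable_withDensity_iff_integrable_smul' (measurable_gaussianPDF 0 1) (ae_of_all _ fun x => gaussianPDF_lt_top)] at h
  simpa using h

lemma pdf_tendsto (l : Filter ℝ) (hl : Filter.Tendsto (fun x : ℝ => x^2) l Filter.atTop) :
   Filter.Tendsto (fun x => - gaussianPDFReal 0 1 x) l (nhds 0) := by
  rw [pdf_def']
  have : Filter.Tendsto (fun x : ℝ => Real.exp (-x^2/2)) l (nhds 0) := by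
    refine Real.tendsto_exp_atBot.comp ?_
    simp only [neg_div]
    exact Filter.tendsto_neg_atTop_atBot.comp (hl.atTop_div_const two_pos)
  simpa using (this.const_mul ((√(2 * Real.pi))⁻¹)).neg

lemma int_right (t : ℝ) : ∫ x in Ici t, x ∂g1 = gaussianPDFReal 0 1 t := by
  rw [g1_eq, restrict_withDensity measurableSet_Ici,
    integral_withDensity_eq_integral_toReal_smul (measurable_gaussianPDF 0 1)
     (ae_of_all _ fun x => gaussianPDF_lt_top)]
  simp only [toReal_gaussianPDF, smul_eq_mul]
  rw [integral_Ici_eq_integral_Ioi, integral_Ioi_of_hasDerivAt_of_tendsto'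
    (fun x _ => pdf_hasDeriv x) pdf_int.integrableOn (pdf_tendsto _ (Filter.tendsto_pow_atTop two_ne_zero))]
  simp

lemma int_left (t : ℝ) : ∫ x in Iio t, x ∂g1 = - gaussianPDFReal 0 1 t := by
  rw [g1_eq, restrict_withDensity measurableSet_Iio,
    integral_withDensity_eq_integral_toReal_smul (measurable_gaussianPDF 0 1)
     (ae_of_all _ fun x => gaussianPDF_lt_top)]
  simp only [toReal_gaussianPDF, smul_eq_mul]
  rw [← integral_Iic_eq_integral_Iio, integral_Iic_of_hasDerivAt_of_tendsto'
    (fun x _ => pdf_hasDeriv x) pdf_int.integrableOn (pdf_tendsto _ ?_)]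
  · simp
  · have := (Filter.tendsto_pow_atTop (α := ℝ) two_ne_zero).comp Filter.tendsto_abs_atBot_atTop
    refine this.congr fun x => ?_
    simp

lemma kernel (t : ℝ) : ∫⁻ y in Iio t, ∫⁻ x in Ici t, ENNReal.ofReal (x - y) ∂g1 ∂g1
    = ENNReal.ofReal (gaussianPDFReal 0 1 t) := by
  have hid : Integrable (fun x : ℝ => x) g1 := (memLp_id_gaussianReal 1).integrable (by simp)
  have h1 : ∀ y ∈ Iio t, ∫⁻ x in Ici t, ENNReal.ofReal (x - y) ∂g1
      = ENNReal.ofReal (gaussianPDFReal 0 1 t - g1.real (Ici t) * y) := by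
    intro y hy
    rw [← ofReal_integral_eq_lintegral_ofReal]
    · rw [integral_sub hid.restrict (integrable_const _), int_right]
      simp
    · exact hid.restrict.sub (integrable_const _)
    · filter_upwards [ae_restrict_mem measurableSet_Ici] with x hx
      simp only [mem_Iio, mem_Ici, Pi.zero_apply] at *
      linarith
  rw [setLIntegral_congr_fun measurableSet_Iio h1, ← ofReal_integral_eq_lintegral_ofReal]
  · rw [integral_sub (integrable_const _) (hid.restrict.const_mul _), integral_const_mul, int_left]
    have : g1.real (Iio t) + g1.real (Ici t) = 1 := by
      rw [← compl_Iio, probReal_compl_eq_one_sub measurableSet_Iio]; ring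
    simp only [integral_const, measureReal_restrict_apply_univ, smul_eq_mul]
    congr 1
    linear_combination gaussianPDFReal 0 1 t * this
  · exact (integrable_const _).sub (hid.restrict.const_mul _)
  · filter_upwards [ae_restrict_mem measurableSet_Iio] with y hy
    have h2 : 0 ≤ ∫ x in Ici t, (x - y) ∂g1 := by
      refine setIntegral_nonneg measurableSet_Ici fun x hx => ?_
      simp only [mem_Iio, mem_Ici] at *
      linarith
    rw [integral_sub hid.restrict (integrable_const _), int_right] at h2
    simpa using h2

lemma cs1 (f f' : ℝ → ℝ) (hf : ∀ x, HasDerivAt f (f' x) x) (hc : Continuous f') {y x : ℝ}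
    (h : y ≤ x) : (f x - f y)^2 ≤ (x - y) * ∫ t in y..x, (f' t)^2 := by
  rcases h.eq_or_lt with rfl | h
  · simp
  have hA : ∫ t in y..x, f' t = f x - f y :=
    intervalIntegral.integral_eq_sub_of_hasDerivAt (fun x _ => hf x) (hc.intervalIntegrable _ _)
  have h0 : 0 ≤ ∫ t in y..x, ((x - y) * f' t - (f x - f y))^2 :=
    intervalIntegral.integral_nonneg h.le fun t _ => sq_nonneg _
  have h1 : ∫ t in y..x, ((x - y) * f' t - (f x - f y))^2 =
      (x-y)^2 * (∫ t in y..x, (f' t)^2) - 2 * (x-y) * (f x - f y) * (∫ t in y..x, f' t)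
        + (f x - f y)^2 * (x - y) := by
    rw [← intervalIntegral.integral_const_mul, ← intervalIntegral.integral_const_mul,
      ← intervalIntegral.integral_sub, 
      show (f x - f y)^2 * (x - y) = ∫ t in y..x, (f x - f y)^2 by
        rw [intervalIntegral.integral_const, smul_eq_mul, mul_comm], ← intervalIntegral.integral_add]
    · congr 1; ext t; ring
    all_goals apply Continuous.intervalIntegrable; fun_prop
  rw [h1, hA] at h0
  have : 0 ≤ (x - y) * ((x - y) * (∫ t in y..x, (f' t)^2) - (f x - f y)^2) := by linarith
  have := nonneg_of_mul_nonneg_right this (by linarith)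
  linarith

open Classical in
noncomputable def kk (F : ℝ → ENNReal) (y x t : ℝ) : ENNReal :=
  if y < t ∧ t ≤ x then ENNReal.ofReal (x - y) * F t else 0

lemma kk_meas {F : ℝ → ENNReal} (hF : Measurable F) :
    Measurable (fun p : ℝ × ℝ × ℝ => kk F p.1 p.2.1 p.2.2) := by
  unfold kk
  refine Measurable.ite ?_ (by fun_prop) measurable_const
  exact (measurableSet_lt measurable_fst measurable_snd.snd).inter
    (measurableSet_le measurable_snd.snd measurable_snd.fst)

lemma cs2 (f f' : ℝ → ℝ) (hf : ∀ x, HasDerivAt f (f' x) x) (hc : Continuous f') {y x : ℝ}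
    (h : y ≤ x) : ENNReal.ofReal ((f x - f y)^2) ≤
      ∫⁻ t, kk (fun t => ENNReal.ofReal ((f' t)^2)) y x t := by
  refine (ENNReal.ofReal_le_ofReal (cs1 f f' hf hc h)).trans ?_
  rw [ENNReal.ofReal_mul (by linarith), intervalIntegral.integral_of_le h,
    ofReal_integral_eq_lintegral_ofReal, ← lintegral_const_mul _ (by fun_prop),
    ← lintegral_indicator measurableSet_Ioc]
  · refine lintegral_mono fun t => ?_
    simp only [kk, Set.indicator, mem_Ioc]
    split_ifs <;> simp
  · exact (Continuous.integrableOn_Icc (by fun_prop)).mono_set Ioc_subset_Icc_self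
  · exact ae_of_all _ fun t => sq_nonneg _

lemma kk_int {F : ℝ → ENNReal} (hF : Measurable F) :
    ∫⁻ y, ∫⁻ x, (∫⁻ t, kk F y x t) ∂g1 ∂g1 = ∫⁻ t, F t ∂g1 := by
  have hk := kk_meas hF
  calc _ = ∫⁻ y, ∫⁻ t, (∫⁻ x, kk F y x t ∂g1) ∂volume ∂g1 := by
        refine lintegral_congr fun y => ?_
        rw [lintegral_lintegral_swap]
        exact (hk.comp (f := fun p : ℝ × ℝ => (y, p.1, p.2)) (by fun_prop)).aemeasurable
    _ = ∫⁻ t, ∫⁻ y, (∫⁻ x, kk F y x t ∂g1) ∂g1 := by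
        rw [lintegral_lintegral_swap]
        refine Measurable.aemeasurable ?_
        refine Measurable.lintegral_prod_right' (f := fun q : (ℝ × ℝ) × ℝ => kk F q.1.1 q.2 q.1.2) ?_
        exact hk.comp (f := fun q : (ℝ × ℝ) × ℝ => (q.1.1, q.2, q.1.2)) (by fun_prop)
    _ = ∫⁻ t, gaussianPDF 0 1 t * F t := by
        refine lintegral_congr fun t => ?_
        have hm : Measurable fun y => ∫⁻ x in Ici t, ENNReal.ofReal (x - y) ∂g1 := by
          refine Measurable.lintegral_prod_right' (f := fun q : ℝ × ℝ => ENNReal.ofReal (q.2 - q.1)) ?_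
          fun_prop
        rw [gaussianPDF, ← kernel t, ← lintegral_mul_const _ hm,
          ← lintegral_indicator measurableSet_Iio]
        refine lintegral_congr fun y => ?_
        by_cases hy : y < t
        · rw [indicator_of_mem (by exact hy), ← lintegral_mul_const _ (by fun_prop),
            ← lintegral_indicator measurableSet_Ici]
          refine lintegral_congr fun x => ?_
          simp [kk, hy, Set.indicator]
        · simp [kk, hy]
    _ = _ := by
        rw [g1_eq, lintegral_withDensity_eq_lintegral_mul _ (measurable_gaussianPDF 0 1) hF]
        rfl

lemma poincare1 (f f' : ℝ → ℝ) (hf : ∀ x, HasDerivAt f (f' x) x) (hc : Continuous f') :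
    ∫⁻ x, ∫⁻ y, ENNReal.ofReal ((f x - f y)^2) ∂g1 ∂g1 ≤
      2 * ∫⁻ t, ENNReal.ofReal ((f' t)^2) ∂g1 := by
  set F := (fun t => ENNReal.ofReal ((f' t)^2)) with hFd
  have hF : Measurable F := by fun_prop
  have hk := kk_meas hF
  have hk2 : Measurable (fun p : ℝ × ℝ => ∫⁻ t, kk F p.1 p.2 t) := by
    refine Measurable.lintegral_prod_right' (f := fun q : (ℝ × ℝ) × ℝ => kk F q.1.1 q.1.2 q.2) ?_
    exact hk.comp (f := fun q : (ℝ × ℝ) × ℝ => (q.1.1, q.1.2, q.2)) (by fun_prop)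
  have key : ∀ x y, ENNReal.ofReal ((f x - f y)^2) ≤ (∫⁻ t, kk F y x t) + ∫⁻ t, kk F x y t := by
    intro x y
    rcases le_total y x with h | h
    · exact (cs2 f f' hf hc h).trans le_self_add
    · rw [sub_sq_comm]
      exact (cs2 f f' hf hc h).trans le_add_self
  calc _ ≤ ∫⁻ x, ∫⁻ y, ((∫⁻ t, kk F y x t) + ∫⁻ t, kk F x y t) ∂g1 ∂g1 :=
        lintegral_mono fun x => lintegral_mono fun y => key x y
    _ = (∫⁻ x, ∫⁻ y, (∫⁻ t, kk F y x t) ∂g1 ∂g1) + ∫⁻ x, ∫⁻ y, (∫⁻ t, kk F x y t) ∂g1 ∂g1 := by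
      rw [← lintegral_add_right]
      · refine lintegral_congr fun x => ?_
        rw [lintegral_add_right]
        exact hk2.comp (f := fun y => (x, y)) (by fun_prop)
      · exact hk2.lintegral_prod_right'
    _ = _ := by
      rw [lintegral_lintegral_swap, kk_int hF, two_mul]
      exact (hk2.comp measurable_swap).aemeasurable

lemma efron_stein {α β : Type*} [MeasurableSpace α] [MeasurableSpace β] (μ : Measure α)
    (ν : Measure β) [IsProbabilityMeasure μ] [IsProbabilityMeasure ν] (F : α × β → ℝ)
    (hF : Measurable F) :
    ∫⁻ p, ∫⁻ q, ENNReal.ofReal ((F p - F q)^2) ∂(μ.prod ν) ∂(μ.prod ν) ≤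
    (∫⁻ v, ∫⁻ a, ∫⁻ b, ENNReal.ofReal ((F (a, v) - F (b, v))^2) ∂μ ∂μ ∂ν) +
    ∫⁻ a, ∫⁻ v, ∫⁻ w, ENNReal.ofReal ((F (a, v) - F (a, w))^2) ∂ν ∂ν ∂μ := by
  set P := (μ.prod μ).prod (ν.prod ν)
  set I := ∫⁻ q, ENNReal.ofReal ((F (q.1.1, q.2.1) - F (q.1.2, q.2.2))^2) ∂P with hI
  set I' := ∫⁻ q, ENNReal.ofReal ((F (q.1.2, q.2.1) - F (q.1.1, q.2.2))^2) ∂P with hI'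
  set T1 := ∫⁻ q, ENNReal.ofReal ((F (q.1.1, q.2.1) - F (q.1.2, q.2.1))^2) ∂P with hT1
  set T1' := ∫⁻ q, ENNReal.ofReal ((F (q.1.1, q.2.2) - F (q.1.2, q.2.2))^2) ∂P with hT1'
  set T2 := ∫⁻ q, ENNReal.ofReal ((F (q.1.1, q.2.1) - F (q.1.1, q.2.2))^2) ∂P with hT2
  set T2' := ∫⁻ q, ENNReal.ofReal ((F (q.1.2, q.2.1) - F (q.1.2, q.2.2))^2) ∂P with hT2'
  have sw1 : MeasurePreserving (Prod.map (Prod.swap : α × α → α × α) (id : β × β → β × β)) P P :=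
    (Measure.measurePreserving_swap).prod (MeasurePreserving.id _)
  have sw2 : MeasurePreserving (Prod.map (id : α × α → α × α) (Prod.swap : β × β → β × β)) P P :=
    (MeasurePreserving.id _).prod (Measure.measurePreserving_swap)
  have eI : I = I' := by
    rw [hI, ← sw1.lintegral_comp (by fun_prop)]; rfl
  have eT1 : T1 = T1' := by
    rw [hT1, ← sw2.lintegral_comp (by fun_prop)]; rfl
  have eT2 : T2 = T2' := by
    rw [hT2, ← sw1.lintegral_comp (by fun_prop)]; rfl
  have main : I + I' ≤ (T1 + T1') + (T2 + T2') := by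
    rw [hI, hI', hT1, hT1', hT2, hT2', ← lintegral_add_left (by fun_prop),
      ← lintegral_add_left (by fun_prop), ← lintegral_add_left (by fun_prop),
      ← lintegral_add_left (by fun_prop)]
    refine lintegral_mono fun q => ?_
    simp only
    rw [← ENNReal.ofReal_add (by positivity) (by positivity),
      ← ENNReal.ofReal_add (by positivity) (by positivity),
      ← ENNReal.ofReal_add (by positivity) (by positivity),
      ← ENNReal.ofReal_add (by positivity) (by positivity)]
    apply ENNReal.ofReal_le_ofReal
    nlinarith [sq_nonneg (F (q.1.1, q.2.1) - F (q.1.2, q.2.1) - F (q.1.1, q.2.2) + F (q.1.2, q.2.2))]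
  rw [← eI, ← eT1, ← eT2, ← two_mul, ← two_mul, ← two_mul, ← mul_add] at main
  have main' : I ≤ T1 + T2 := (ENNReal.mul_le_mul_iff_right (by simp) (by simp)).1 main
  convert main' using 1
  · rw [hI, lintegral_prod _ (by fun_prop), lintegral_prod _ (by fun_prop),
      lintegral_prod _ (by fun_prop)]
    refine lintegral_congr fun a => ?_
    have : ∀ b, ∫⁻ q : β × β, ENNReal.ofReal ((F (a, q.1) - F (b, q.2))^2) ∂(ν.prod ν) =
      ∫⁻ v, ∫⁻ w, ENNReal.ofReal ((F (a, v) - F (b, w))^2) ∂ν ∂ν := fun b =>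
        lintegral_prod _ (by fun_prop)
    simp only [this]
    symm
    rw [lintegral_lintegral_swap]
    · refine lintegral_congr fun v => ?_
      rw [lintegral_prod _ (by fun_prop)]
    · refine Measurable.aemeasurable ?_
      refine Measurable.lintegral_prod_right'
        (f := fun q : (α × β) × β => ENNReal.ofReal ((F (a, q.1.2) - F (q.1.1, q.2))^2)) ?_
      fun_prop
  · congr 1
    · rw [hT1, lintegral_prod_symm _ (by fun_prop), lintegral_prod _ ?_]
      · refine lintegral_congr fun v => ?_
        dsimp only
        rw [lintegral_const, measure_univ, mul_one, lintegral_prod _ (by fun_prop)]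
      · refine Measurable.aemeasurable ?_
        refine Measurable.lintegral_prod_left'
          (f := fun q : (α × α) × (β × β) => ENNReal.ofReal ((F (q.1.1, q.2.1) - F (q.1.2, q.2.1))^2)) ?_
        fun_prop
    · rw [hT2, lintegral_prod _ (by fun_prop), lintegral_prod _ ?_]
      · refine lintegral_congr fun v => ?_
        dsimp only
        rw [lintegral_const, measure_univ, mul_one, lintegral_prod _ (by fun_prop)]
      · refine Measurable.aemeasurable ?_
        refine Measurable.lintegral_prod_right'
          (f := fun q : (α × α) × (β × β) => ENNReal.ofReal ((F (q.1.1, q.2.1) - F (q.1.1, q.2.2))^2)) ?_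
        fun_prop

lemma hasDeriv_line {n : ℕ} (f : (Fin n → ℝ) → ℝ) (hf : Differentiable ℝ f) (x u : Fin n → ℝ) (a : ℝ) :
    HasDerivAt (fun t : ℝ => f (x + t • u)) (fderiv ℝ f (x + a • u) u) a := by
  have h1 : HasDerivAt (fun t : ℝ => x + t • u) u a := by
    simpa using ((hasDerivAt_id a).smul_const u).const_add x
  exact (hf (x + a • u)).hasFDerivAt.comp_hasDerivAt a h1

lemma pgrad_comp {n m : ℕ} (f : (Fin n → ℝ) → ℝ) (hf : Differentiable ℝ f)
    (h : (Fin m → ℝ) → (Fin n → ℝ)) (hh : Differentiable ℝ h) (v : Fin m → ℝ) (i : Fin m)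
    (u : Fin n → ℝ) (hu : ∀ t : ℝ, h (v + t • Pi.single i 1) = h v + t • u) :
    pgrad (fun v => f (h v)) v i = fderiv ℝ f (h v) u := by
  have h1 := hasDeriv_line (fun v => f (h v)) (hf.comp hh) v (Pi.single i 1) 0
  have h2 := hasDeriv_line f hf (h v) u 0
  simp only [hu] at h1
  have := h1.unique h2
  simpa [pgrad] using this

lemma mp_cons (n : ℕ) : MeasurePreserving (fun p : ℝ × (Fin n → ℝ) => (Fin.cons p.1 p.2 : Fin (n+1) → ℝ))
    (g1.prod (gN n)) (gN (n+1)) := by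
  have := (measurePreserving_piFinSuccAbove (fun _ : Fin (n+1) => g1) 0).symm
  convert this using 1
  funext p
  simp [MeasurableEquiv.piFinSuccAbove, Fin.insertNthEquiv]

lemma cons_add {n : ℕ} (a b : ℝ) (v w : Fin n → ℝ) :
    (Fin.cons (a + b) (v + w) : Fin (n+1) → ℝ) = Fin.cons a v + Fin.cons b w := by
  ext i; refine Fin.cases ?_ (fun j => ?_) i <;> simp

lemma continuous_pgrad {n : ℕ} (f : (Fin n → ℝ) → ℝ) (hf : ContDiff ℝ 1 f) (i : Fin n) :
    Continuous (fun x => pgrad f x i) := by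
  unfold pgrad
  exact (hf.continuous_fderiv (by simp)).clm_apply continuous_const

lemma poincareN (n : ℕ) : ∀ (f : (Fin n → ℝ) → ℝ) (_ : ContDiff ℝ 1 f),
    ∫⁻ x, ∫⁻ y, ENNReal.ofReal ((f x - f y)^2) ∂(gN n) ∂(gN n) ≤
      2 * ∑ i, ∫⁻ x, ENNReal.ofReal ((pgrad f x i)^2) ∂(gN n) := by
  induction n with
  | zero =>
    intro f hf
    have : ∀ x y, f x - f y = 0 := fun x y => by rw [Subsingleton.elim x y, sub_self]
    simp [this]
  | succ n ih =>
    intro f hf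
    have hfc := hf.continuous
    have hfd : Differentiable ℝ f := hf.differentiable (by simp)
    have mp := mp_cons n
    have hcm : Continuous (fun p : ℝ × (Fin n → ℝ) => (Fin.cons p.1 p.2 : Fin (n+1) → ℝ)) := by
      refine continuous_pi fun i => Fin.cases ?_ (fun j => ?_) i
      · simpa using continuous_fst
      · simp only [Fin.cons_succ]; fun_prop
    set F : ℝ × (Fin n → ℝ) → ℝ := fun p => f (Fin.cons p.1 p.2) with hFdef
    have hF : Continuous F := hfc.comp hcm
    have hL : ∫⁻ x, ∫⁻ y, ENNReal.ofReal ((f x - f y)^2) ∂(gN (n+1)) ∂(gN (n+1)) =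
        ∫⁻ p, ∫⁻ q, ENNReal.ofReal ((F p - F q)^2) ∂(g1.prod (gN n)) ∂(g1.prod (gN n)) := by
      rw [← mp.lintegral_comp]
      · refine lintegral_congr fun p => ?_
        rw [← mp.lintegral_comp (by fun_prop)]
      · refine Measurable.lintegral_prod_right' 
          (f := fun q : (Fin (n+1) → ℝ) × (Fin (n+1) → ℝ) => ENNReal.ofReal ((f q.1 - f q.2)^2)) ?_
        fun_prop
    have hR : ∀ i, ∫⁻ x, ENNReal.ofReal ((pgrad f x i)^2) ∂(gN (n+1)) =
        ∫⁻ p, ENNReal.ofReal ((pgrad f (Fin.cons p.1 p.2) i)^2) ∂(g1.prod (gN n)) := by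
      intro i
      have := continuous_pgrad f hf i
      rw [← mp.lintegral_comp (by fun_prop)]
    have hcg : ∀ i, Continuous fun p : ℝ × (Fin n → ℝ) => pgrad f (Fin.cons p.1 p.2) i :=
      fun i => (continuous_pgrad f hf i).comp hcm
    have hmg : ∀ i, Measurable fun p : ℝ × (Fin n → ℝ) =>
        ENNReal.ofReal ((pgrad f (Fin.cons p.1 p.2) i)^2) :=
      fun i => ((hcg i).measurable.pow_const 2).ennreal_ofReal
    rw [hL]
    refine (efron_stein g1 (gN n) F hF.measurable).trans ?_
    rw [Fin.sum_univ_succ, mul_add]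
    refine add_le_add ?_ ?_
    · rw [hR, lintegral_prod_symm _ (hmg 0).aemeasurable, ← lintegral_const_mul]
      · refine lintegral_mono fun v => ?_
        refine poincare1 (fun a => F (a, v)) (fun a => pgrad f (Fin.cons a v) 0) ?_ ?_
        · intro a
          have hc : ∀ t : ℝ, (Fin.cons t v : Fin (n+1) → ℝ) = Fin.cons 0 v + t • Pi.single 0 1 := by
            intro t
            ext i; refine Fin.cases ?_ (fun j => ?_) i <;> simp
          have := hasDeriv_line f hfd (Fin.cons 0 v) (Pi.single 0 1) a
          simp only [← hc] at this
          exact this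
        · exact (hcg 0).comp (by fun_prop : Continuous fun a : ℝ => (a, v))
      · refine Measurable.lintegral_prod_left' (f := fun p : ℝ × (Fin n → ℝ) => ENNReal.ofReal ((pgrad f (Fin.cons p.1 p.2) 0)^2)) ?_
        exact hmg 0
    · have hm : ∀ i : Fin n, Measurable fun a : ℝ => ∫⁻ v, ENNReal.ofReal ((pgrad f (Fin.cons a v) i.succ)^2) ∂(gN n) := by
        intro i
        refine Measurable.lintegral_prod_right' (f := fun p : ℝ × (Fin n → ℝ) => ENNReal.ofReal ((pgrad f (Fin.cons p.1 p.2) i.succ)^2)) ?_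
        exact hmg i.succ
      have : ∀ i : Fin n, ∫⁻ x, ENNReal.ofReal ((pgrad f x i.succ)^2) ∂(gN (n+1)) =
        ∫⁻ a, ∫⁻ v, ENNReal.ofReal ((pgrad f (Fin.cons a v) i.succ)^2) ∂(gN n) ∂g1 := by
        intro i
        rw [hR, lintegral_prod _ (hmg i.succ).aemeasurable]
      simp_rw [this]
      rw [← lintegral_finsetSum _ (fun i _ => hm i), ← lintegral_const_mul _ (Finset.measurable_sum _ fun i _ => hm i)]
      refine lintegral_mono fun a => ?_
      have hcons : ContDiff ℝ 1 (fun v : Fin n → ℝ => (Fin.cons a v : Fin (n+1) → ℝ)) := by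
        refine contDiff_pi.2 fun i => Fin.cases ?_ (fun j => ?_) i
        · simpa using contDiff_const
        · simpa using contDiff_apply ℝ ℝ j
      refine (ih (fun v => f (Fin.cons a v)) (hf.comp hcons)).trans_eq ?_
      congr 1
      refine Finset.sum_congr rfl fun i _ => lintegral_congr fun v => ?_
      rw [pgrad_comp f hfd (fun v => Fin.cons a v) (hcons.differentiable (by simp)) v i (Pi.single i.succ 1)]
      · rfl
      · intro t
        ext l; refine Fin.cases ?_ (fun j => ?_) l <;> simp [Pi.single_apply]

lemma variance_bound {m : ℕ} (h : (Fin m → ℝ) → ℝ) (hc : Continuous h) :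
    2 * ∫⁻ z, ENNReal.ofReal ((h z - ∫ w, h w ∂(gN m))^2) ∂(gN m) ≤
      ∫⁻ x, ∫⁻ y, ENNReal.ofReal ((h x - h y)^2) ∂(gN m) ∂(gN m) := by
  by_cases hfin : ∫⁻ x, ∫⁻ y, ENNReal.ofReal ((h x - h y)^2) ∂(gN m) ∂(gN m) = ⊤
  · rw [hfin]; exact le_top
  have hmeas : Measurable fun x => ∫⁻ y, ENNReal.ofReal ((h x - h y)^2) ∂(gN m) := by
    refine Measurable.lintegral_prod_right'
      (f := fun q : (Fin m → ℝ) × (Fin m → ℝ) => ENNReal.ofReal ((h q.1 - h q.2)^2)) ?_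
    fun_prop
  obtain ⟨x0, hx0⟩ := (ae_lt_top hmeas hfin).exists
  have hL : MemLp (fun y => h x0 - h y) 2 (gN m) := by
    rw [memLp_two_iff_integrable_sq (by fun_prop)]
    refine ⟨by fun_prop, ?_⟩
    rw [hasFiniteIntegral_iff_ofReal (ae_of_all _ fun y => sq_nonneg _)]
    exact hx0
  have hL2 : MemLp h 2 (gN m) := by
    have := (memLp_const (h x0) : MemLp (fun _ => h x0) 2 (gN m)).sub hL
    convert this using 1
    ext y; simp
  have hi : Integrable h (gN m) := hL2.integrable (by norm_num)
  have hi2 : Integrable (fun y => h y ^ 2) (gN m) := hL2.integrable_sq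
  set c := ∫ w, h w ∂(gN m) with hcdef
  set V := ∫ w, (h w - c)^2 ∂(gN m) with hV
  have hic : Integrable (fun w => (h w - c)^2) (gN m) :=
    (hL2.sub (memLp_const c)).integrable_sq
  have hV0 : 0 ≤ V := integral_nonneg fun _ => sq_nonneg _
  have hVl : ENNReal.ofReal V = ∫⁻ w, ENNReal.ofReal ((h w - c)^2) ∂(gN m) :=
    ofReal_integral_eq_lintegral_ofReal hic (ae_of_all _ fun _ => sq_nonneg _)
  have hin : ∀ x, ∫⁻ y, ENNReal.ofReal ((h x - h y)^2) ∂(gN m) =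
      ENNReal.ofReal ((h x - c)^2) + ENNReal.ofReal V := by
    intro x
    rw [← ENNReal.ofReal_add (sq_nonneg _) hV0, ← ofReal_integral_eq_lintegral_ofReal]
    · congr 1
      have e : ∀ y, (h x - h y)^2 = ((h x - c)^2 + (h y - c)^2) - (2 * (h x - c)) * (h y - c) := by
        intro y; ring
      simp_rw [e]
      rw [integral_sub, integral_add, integral_const_mul, integral_sub]
      · simp [← hcdef, hV]
      · exact hi
      · exact integrable_const _
      · exact integrable_const _
      · exact hic
      · exact (integrable_const _).add hic
      · exact (hi.sub (integrable_const _)).const_mul _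
    · exact ((memLp_const (h x)).sub hL2).integrable_sq
    · exact ae_of_all _ fun _ => sq_nonneg _
  simp_rw [hin]
  rw [lintegral_add_right _ measurable_const, lintegral_const, measure_univ, mul_one, hVl, two_mul]

lemma mp_append (k m : ℕ) : MeasurePreserving
    (fun p : (Fin k → ℝ) × (Fin m → ℝ) => Fin.append p.1 p.2)
    ((gN k).prod (gN m)) (gN (k+m)) := by
  have h1 := measurePreserving_sumPiEquivProdPi_symm (fun _ : Fin k ⊕ Fin m => g1)
  have h2 := measurePreserving_piCongrLeft (fun _ : Fin (k+m) => g1) finSumFinEquiv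
  have := h2.comp h1
  convert this using 1
  funext p
  ext i
  refine Fin.addCases (fun j => ?_) (fun j => ?_) i
  · simp only [Fin.append_left, Function.comp]
    rw [← finSumFinEquiv_apply_left, MeasurableEquiv.coe_piCongrLeft, Equiv.piCongrLeft_apply_apply]
    rfl
  · simp only [Fin.append_right, Function.comp]
    rw [← finSumFinEquiv_apply_right, MeasurableEquiv.coe_piCongrLeft, Equiv.piCongrLeft_apply_apply]
    rfl

lemma mp_rot (n : ℕ) (W : Matrix (Fin n) (Fin n) ℝ) (hW : Wᵀ * W = 1) :
    MeasurePreserving (fun x => W *ᵥ x) (gN n) (gN n) := by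
  have hdet : |W.det| = 1 := by
    have := congrArg Matrix.det hW
    rw [det_mul, det_transpose, det_one] at this
    rw [← sq_eq_sq₀ (abs_nonneg _) zero_le_one, sq_abs]
    linarith
  have hdet0 : W.det ≠ 0 := by
    intro h; simp [h] at hdet
  have hvol : MeasurePreserving (fun x => W *ᵥ x) (volume : Measure (Fin n → ℝ)) volume := by
    refine ⟨by fun_prop, ?_⟩
    have := Real.map_matrix_volume_pi_eq_smul_volume_pi hdet0
    rw [abs_inv, hdet, inv_one, ENNReal.ofReal_one, one_smul] at this
    exact this
  have hcont : Continuous (fun x : Fin n → ℝ => W *ᵥ x) := by fun_prop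
  have hd : ∀ x, gaussDensity n (W *ᵥ x) = gaussDensity n x := by
    intro x
    have : ∑ i, (W *ᵥ x) i ^ 2 = ∑ i, x i ^ 2 := by
      have h1 : ∀ v : Fin n → ℝ, ∑ i, v i ^ 2 = v ⬝ᵥ v := fun v => by simp [dotProduct, sq]
      rw [h1, h1, dotProduct_mulVec, vecMul_mulVec, hW, vecMul_one]
    simp [gaussDensity, this]
  have hdc : Measurable fun x => ENNReal.ofReal (gaussDensity n x) := by
    unfold gaussDensity
    fun_prop
  refine ⟨hcont.measurable, ?_⟩
  ext s hs
  rw [Measure.map_apply hcont.measurable hs, gN_eq, withDensity_apply _ (hcont.measurable hs),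
    withDensity_apply _ hs, ← hvol.setLIntegral_comp_preimage hs hdc]
  simp_rw [hd]

lemma lint_density (n : ℕ) (G : (Fin n → ℝ) → ℝ) (hG : Measurable G) (h0 : ∀ x, 0 ≤ G x) :
    ∫⁻ x, ENNReal.ofReal (G x * gaussDensity n x) = ∫⁻ x, ENNReal.ofReal (G x) ∂(gN n) := by
  have hdc : Measurable fun x => ENNReal.ofReal (gaussDensity n x) := by
    unfold gaussDensity
    fun_prop
  rw [gN_eq, lintegral_withDensity_eq_lintegral_mul _ hdc (by fun_prop)]
  refine lintegral_congr fun x => ?_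
  rw [ENNReal.ofReal_mul (h0 x), mul_comm]
  rfl

lemma int_density (n : ℕ) (G : (Fin n → ℝ) → ℝ) :
    ∫ x, G x * gaussDensity n x = ∫ x, G x ∂(gN n) := by
  have hdc : Measurable fun x => ENNReal.ofReal (gaussDensity n x) := by
    unfold gaussDensity
    fun_prop
  rw [gN_eq, integral_withDensity_eq_integral_toReal_smul hdc (ae_of_all _ fun _ => ENNReal.ofReal_lt_top)]
  refine integral_congr_ae (ae_of_all _ fun x => ?_)
  have : 0 ≤ gaussDensity n x := by unfold gaussDensity; positivity
  simp [ENNReal.toReal_ofReal this, mul_comm]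

lemma dir_energy {n : ℕ} (f : (Fin n → ℝ) → ℝ) (hf : ContDiff ℝ 1 f)
    (hsq : ∀ i, Integrable fun x => (pgrad f x i) ^ 2 * gaussDensity n x)
    (W : Matrix (Fin n) (Fin n) ℝ) (hW : Wᵀ * W = 1) (Λ : Fin n → ℝ)
    (hC : (Matrix.of fun i j => ∫ x, pgrad f x i * pgrad f x j * gaussDensity n x) =
      W * Matrix.diagonal Λ * Wᵀ) (j : Fin n) :
    ∫⁻ x, ENNReal.ofReal ((fderiv ℝ f x (fun i => W i j))^2) ∂(gN n) = ENNReal.ofReal (Λ j) := by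
  have hd0 : ∀ x, 0 ≤ gaussDensity n x := fun x => by unfold gaussDensity; positivity
  have hdc : Continuous (gaussDensity n) := by
    unfold gaussDensity
    fun_prop
  have hfd : Continuous (fun x => fderiv ℝ f x (fun i => W i j)) :=
    (hf.continuous_fderiv (by simp)).clm_apply continuous_const
  have hexp : ∀ x, fderiv ℝ f x (fun i => W i j) = ∑ i, W i j * pgrad f x i := by
    intro x
    have : (fun i => W i j) = ∑ i, W i j • (Pi.single i 1 : Fin n → ℝ) := by
      ext l; simp [Finset.sum_apply, Pi.single_apply]
    rw [this, map_sum]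
    simp [pgrad]
  have hint : ∀ i l, Integrable fun x => pgrad f x i * pgrad f x l * gaussDensity n x := by
    intro i l
    have ci := continuous_pgrad f hf i
    have cl := continuous_pgrad f hf l
    refine ((hsq i).add (hsq l)).mono' (by fun_prop) (ae_of_all _ fun x => ?_)
    rw [Real.norm_eq_abs, abs_mul, abs_of_nonneg (hd0 x), Pi.add_apply, ← add_mul]
    refine mul_le_mul_of_nonneg_right ?_ (hd0 x)
    rw [abs_le]
    constructor <;> nlinarith [sq_nonneg (pgrad f x i + pgrad f x l), sq_nonneg (pgrad f x i - pgrad f x l), sq_nonneg (pgrad f x i), sq_nonneg (pgrad f x l)]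
  have hsum : ∀ x, (fderiv ℝ f x (fun i => W i j))^2 * gaussDensity n x =
      ∑ i, ∑ l, W i j * W l j * (pgrad f x i * pgrad f x l * gaussDensity n x) := by
    intro x
    rw [hexp, sq, Finset.sum_mul_sum, Finset.sum_mul]
    refine Finset.sum_congr rfl fun i _ => ?_
    rw [Finset.sum_mul]
    refine Finset.sum_congr rfl fun l _ => ?_
    ring
  have hint2 : Integrable fun x => (fderiv ℝ f x (fun i => W i j))^2 * gaussDensity n x := by
    simp_rw [hsum]
    exact integrable_finsetSum _ fun i _ => integrable_finsetSum _ fun l _ => (hint i l).const_mul _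
  have hval : ∫ x, (fderiv ℝ f x (fun i => W i j))^2 * gaussDensity n x = Λ j := by
    simp_rw [hsum]
    rw [integral_finsetSum _ fun i _ => integrable_finsetSum _ fun l _ => (hint i l).const_mul _]
    simp_rw [integral_finsetSum _ fun l _ => (hint _ l).const_mul _, integral_const_mul]
    have hWC : (Wᵀ * (Matrix.of fun i j => ∫ x, pgrad f x i * pgrad f x j * gaussDensity n x) * W) j j = Λ j := by
      rw [hC]
      have : Wᵀ * (W * Matrix.diagonal Λ * Wᵀ) * W = (Wᵀ * W) * Matrix.diagonal Λ * (Wᵀ * W) := by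
        simp only [Matrix.mul_assoc]
      rw [this, hW]
      simp
    rw [← hWC, Matrix.mul_apply]
    simp_rw [Matrix.mul_apply, Finset.sum_mul]
    rw [Finset.sum_comm]
    refine Finset.sum_congr rfl fun i _ => Finset.sum_congr rfl fun l _ => ?_
    simp only [transpose_apply, of_apply]
    ring
  rw [← lint_density _ _ (by fun_prop) (fun x => sq_nonneg _), ← hval,
    ofReal_integral_eq_lintegral_ofReal hint2 (ae_of_all _ fun x => mul_nonneg (sq_nonneg _) (hd0 x))]

lemma mulVec_append' {k m : ℕ} (W : Matrix (Fin (k + m)) (Fin (k + m)) ℝ) (y : Fin k → ℝ) (z : Fin m → ℝ) :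
    W *ᵥ Fin.append y z = W.submatrix id (Fin.castAdd m) *ᵥ y + W.submatrix id (Fin.natAdd k) *ᵥ z := by
  ext i
  simp [mulVec, dotProduct, Fin.sum_univ_add]

/-- Poincaré-type bound for the active subspace ridge approximation in the
Gaussian case: with `ρX` standard normal on `ℝ^(k+m)`, `C = ∫ ∇f ∇fᵀ ρX dx = W Λ Wᵀ`,
`g(y) = ∫ f(W₁y + W₂z) φ_m(z) dz` and `f_g(x) = g(W₁ᵀx)`, one has
`∫ (f - f_g)² ρX dx ≤ λ_{k+1} + ⋯ + λ_{k+m}`. -/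
theorem mse_conditional_expectation_bound
    (k m : ℕ)
    (f : (Fin (k + m) → ℝ) → ℝ)
    (hf : ContDiff ℝ 1 f)
    (hsq : ∀ i, Integrable fun x => (pgrad f x i) ^ 2 * gaussDensity (k + m) x)
    (W : Matrix (Fin (k + m)) (Fin (k + m)) ℝ)
    (hW : Wᵀ * W = 1)
    (Λ : Fin (k + m) → ℝ)
    (hΛdesc : ∀ i j, i ≤ j → Λ j ≤ Λ i)
    (hΛnonneg : ∀ i, 0 ≤ Λ i)
    (hC : (Matrix.of fun i j => ∫ x, pgrad f x i * pgrad f x j * gaussDensity (k + m) x) =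
      W * Matrix.diagonal Λ * Wᵀ)
    (g : (Fin k → ℝ) → ℝ)
    (hg : ∀ y, g y = ∫ z, f (W.submatrix id (Fin.castAdd m) *ᵥ y +
      W.submatrix id (Fin.natAdd k) *ᵥ z) * gaussDensity m z) :
    ∫ x, (f x - g ((W.submatrix id (Fin.castAdd m))ᵀ *ᵥ x)) ^ 2 * gaussDensity (k + m) x ≤
      ∑ j : Fin m, Λ (Fin.natAdd k j) := by
  have hd0 : ∀ x, 0 ≤ gaussDensity (k + m) x := fun x => by unfold gaussDensity; positivity
  have hfc := hf.continuous
  have hfd : Differentiable ℝ f := hf.differentiable (by simp)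
  set W1 := W.submatrix id (Fin.castAdd m) with hW1
  set W2 := W.submatrix id (Fin.natAdd k) with hW2
  have hg' : ∀ y, g y = ∫ z, f (W1 *ᵥ y + W2 *ᵥ z) ∂(gN m) := fun y => by
    rw [hg, int_density m (fun z => f (W1 *ᵥ y + W2 *ᵥ z))]
  have hgm : Measurable g := by
    rw [funext hg']
    refine StronglyMeasurable.measurable ?_
    refine StronglyMeasurable.integral_prod_right'
      (f := fun p : (Fin k → ℝ) × (Fin m → ℝ) => f (W1 *ᵥ p.1 + W2 *ᵥ p.2)) ?_
    exact Continuous.stronglyMeasurable (by fun_prop)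
  have hW1c : Continuous fun x : Fin (k+m) → ℝ => W1ᵀ *ᵥ x := by fun_prop
  have hTm : Measurable fun x => (f x - g (W1ᵀ *ᵥ x))^2 :=
    (hfc.measurable.sub (hgm.comp hW1c.measurable)).pow_const 2
  have hproj : ∀ y z, W1ᵀ *ᵥ (W *ᵥ Fin.append y z) = y := by
    intro y z
    ext i
    have : W1ᵀ *ᵥ (W *ᵥ Fin.append y z) = fun i => (Wᵀ *ᵥ (W *ᵥ Fin.append y z)) (Fin.castAdd m i) := rfl
    rw [this, mulVec_mulVec, hW, one_mulVec]
    simp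
  have hrot := (mp_rot (k+m) W hW).comp (mp_append k m)
  have hchange : ∀ G : (Fin (k+m) → ℝ) → ENNReal, Measurable G →
      ∫⁻ x, G x ∂(gN (k+m)) = ∫⁻ y, ∫⁻ z, G (W1 *ᵥ y + W2 *ᵥ z) ∂(gN m) ∂(gN k) := by
    intro G hG
    rw [← hrot.lintegral_comp hG, lintegral_prod]
    swap
    · exact (hG.comp hrot.measurable).aemeasurable
    simp only [Function.comp, mulVec_append', hW1, hW2]
  have hproj' : ∀ y z, W1ᵀ *ᵥ (W1 *ᵥ y + W2 *ᵥ z) = y := fun y z => by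
    have := hproj y z
    rwa [mulVec_append'] at this
  have hDc : ∀ j, Continuous fun x => fderiv ℝ f x (fun i => W i j) := fun j =>
    (hf.continuous_fderiv (by simp)).clm_apply continuous_const
  have key : ∀ y, ∫⁻ z, ENNReal.ofReal ((f (W1 *ᵥ y + W2 *ᵥ z) - g y)^2) ∂(gN m) ≤
      ∑ j : Fin m, ∫⁻ z, ENNReal.ofReal
        ((fderiv ℝ f (W1 *ᵥ y + W2 *ᵥ z) (fun i => W i (Fin.natAdd k j)))^2) ∂(gN m) := by
    intro y
    have hlin : ContDiff ℝ 1 (fun z : Fin m → ℝ => W1 *ᵥ y + W2 *ᵥ z) :=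
      contDiff_const.add (W2.mulVecLin.toContinuousLinearMap.contDiff)
    have h1 := variance_bound (fun z => f (W1 *ᵥ y + W2 *ᵥ z)) (by fun_prop)
    have h2 := poincareN m (fun z => f (W1 *ᵥ y + W2 *ᵥ z)) (hf.comp hlin)
    have h3 := (ENNReal.mul_le_mul_iff_right (by simp) (by simp)).1 (h1.trans h2)
    rw [← hg'] at h3
    refine h3.trans_eq ?_
    refine Finset.sum_congr rfl fun j _ => lintegral_congr fun z => ?_
    rw [pgrad_comp f hfd (fun z => W1 *ᵥ y + W2 *ᵥ z) (hlin.differentiable (by simp)) z j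
      (fun i => W i (Fin.natAdd k j))]
    intro t
    rw [mulVec_add, mulVec_smul, mulVec_single_one, add_assoc]
    rfl
  have hmain : ∫⁻ x, ENNReal.ofReal ((f x - g (W1ᵀ *ᵥ x))^2 * gaussDensity (k+m) x) ≤
      ENNReal.ofReal (∑ j : Fin m, Λ (Fin.natAdd k j)) := by
    rw [lint_density _ _ hTm (fun x => sq_nonneg _), hchange _ hTm.ennreal_ofReal]
    simp_rw [hproj']
    refine (lintegral_mono key).trans ?_
    rw [lintegral_finsetSum, ENNReal.ofReal_sum_of_nonneg (fun j _ => hΛnonneg _)]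
    · refine Finset.sum_le_sum fun j _ => ?_
      rw [← dir_energy f hf hsq W hW Λ hC, hchange]
      have := hDc (Fin.natAdd k j)
      fun_prop
    · intro j _
      refine Measurable.lintegral_prod_right' (f := fun p : (Fin k → ℝ) × (Fin m → ℝ) =>
        ENNReal.ofReal ((fderiv ℝ f (W1 *ᵥ p.1 + W2 *ᵥ p.2) (fun i => W i (Fin.natAdd k j)))^2)) ?_
      have : Continuous fun p : (Fin k → ℝ) × (Fin m → ℝ) => W1 *ᵥ p.1 + W2 *ᵥ p.2 := by fun_prop
      exact (((hDc (Fin.natAdd k j)).comp this).measurable.pow_const 2).ennreal_ofReal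
  have hdm : Measurable (gaussDensity (k+m)) := by
    unfold gaussDensity
    fun_prop
  rw [integral_eq_lintegral_of_nonneg_ae (ae_of_all _ fun x => mul_nonneg (sq_nonneg _) (hd0 x))
    (hTm.mul hdm).aestronglyMeasurable]
  exact ENNReal.toReal_le_of_le_ofReal (Finset.sum_nonneg fun j _ => hΛnonneg _) hmain
end
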